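/- Fix d ≥ 1. Let φ : ℝ^d → ℝ be a nonnegative integrable radially symmetric function (φ(y₁) = φ(y₂) whenever |y₁| = |y₂|) with support contained in the closed unit ball B̄₁ of ℝ^d, normalized so that ∫_{ℝ^d} |y|² φ(y) dy = d. Let M be a symmetric positive definite d×d real matrix and let w : ℝ^d → ℝ be bounded, measurable, and twice continuously differentiable on a neighborhood of a point x ∈ ℝ^d. Then I_ε^M w(x) → M² : D²w(x) = tr(M² D²w(x)) as ε → 0⁺. -/

import Mathlib

open MeasureTheory Matrix

/-- The centered second difference `𝔡w(x,y) = w(x+y) - 2w(x) + w(x-y)`. -/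
noncomputable def centeredSecondDiff {d : ℕ} (w : EuclideanSpace ℝ (Fin d) → ℝ)
    (x y : EuclideanSpace ℝ (Fin d)) : ℝ :=
  w (x + y) - 2 * w x + w (x - y)

/-- The integral operator
`I_ε^M w(x) := (ε^{d+2} det M)⁻¹ ∫ 𝔡w(x,y) φ(M⁻¹y/ε) dy`. -/
noncomputable def intOp {d : ℕ} (φ : EuclideanSpace ℝ (Fin d) → ℝ) (ε : ℝ)
    (M : Matrix (Fin d) (Fin d) ℝ) (w : EuclideanSpace ℝ (Fin d) → ℝ)
    (x : EuclideanSpace ℝ (Fin d)) : ℝ :=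
  (ε ^ (d + 2) * M.det)⁻¹ *
    ∫ y : EuclideanSpace ℝ (Fin d),
      centeredSecondDiff w x y * φ (ε⁻¹ • Matrix.toEuclideanLin M⁻¹ y)

open Filter Topology Asymptotics

/-- Second-order Peano expansion of the centered second difference of a function that is `C²`
at a point. -/
lemma ContDiffAt.centered_second_difference_isLittleO {E : Type*} [NormedAddCommGroup E]
    [NormedSpace ℝ E] {w : E → ℝ} {x : E} (h : ContDiffAt ℝ 2 w x) :
    (fun y => w (x + y) - 2 * w x + w (x - y) - fderiv ℝ (fderiv ℝ w) x y y)
      =o[𝓝 0] fun y => ‖y‖ ^ 2 := by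
  set B := fderiv ℝ (fderiv ℝ w) x with hB
  have hD : HasFDerivAt (fderiv ℝ w) B x :=
    ((h.fderiv_right (m := 1) (by norm_num)).differentiableAt (by norm_num)).hasFDerivAt
  have hplus : (fun y => fderiv ℝ w (x + y) - fderiv ℝ w x - B y) =o[𝓝 0] fun y => y :=
    hasFDerivAt_iff_isLittleO_nhds_zero.1 hD
  have hneg : Tendsto (fun y : E => -y) (𝓝 0) (𝓝 0) := by
    simpa using (continuous_neg (G := E)).tendsto 0
  have hminus : (fun y => fderiv ℝ w (x - y) - fderiv ℝ w x + B y) =o[𝓝 0] fun y => y := by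
    have := (hplus.comp_tendsto hneg).neg_right
    simpa [Function.comp_def, sub_eq_add_neg] using this
  have hdiff : (fun y => fderiv ℝ w (x + y) - fderiv ℝ w (x - y) - (B y + B y))
      =o[𝓝 0] fun y => y := by
    refine (hplus.sub hminus).congr_left fun y => ?_
    abel
  have hsymm : ∀ u v, B u v = B v u := fun u v =>
    (h.isSymmSndFDerivAt (by simp)).eq u v
  have hdw : ∀ᶠ z in 𝓝 x, DifferentiableAt ℝ w z :=
    (h.eventually (by simp)).mono fun z hz => hz.differentiableAt (by norm_num)
  have tplus : Tendsto (fun y : E => x + y) (𝓝 0) (𝓝 x) := by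
    simpa using (continuous_const_add x).tendsto (0 : E)
  have tminus : Tendsto (fun y : E => x - y) (𝓝 0) (𝓝 x) := by
    simpa using (continuous_sub_left x).tendsto (0 : E)
  rw [isLittleO_iff]
  intro c hc
  obtain ⟨r, hr, hball⟩ := Metric.eventually_nhds_iff_ball.1
    ((hdiff.def hc).and ((tplus.eventually hdw).and (tminus.eventually hdw)))
  filter_upwards [Metric.ball_mem_nhds 0 hr] with y hy
  have hderiv : ∀ z ∈ Metric.closedBall (0 : E) ‖y‖,
      HasFDerivWithinAt (fun y => w (x + y) - 2 * w x + w (x - y) - B y y)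
        (fderiv ℝ w (x + z) - fderiv ℝ w (x - z) - (B z + B z))
        (Metric.closedBall (0 : E) ‖y‖) z := by
    intro z hz
    obtain ⟨-, h1, h2⟩ := hball z (by
      simp only [mem_closedBall_zero_iff, mem_ball_zero_iff] at hz hy ⊢
      exact hz.trans_lt hy)
    have d1 : HasFDerivAt (fun y => w (x + y)) (fderiv ℝ w (x + z)) z := by
      exact h1.hasFDerivAt.comp z ((hasFDerivAt_id z).const_add x)
    have d2 : HasFDerivAt (fun y => w (x - y)) (-fderiv ℝ w (x - z)) z := by
      simpa [Function.comp_def] using h2.hasFDerivAt.comp z ((hasFDerivAt_id z).const_sub x)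
    have d3 : HasFDerivAt (fun y => B y y) (B z + B z) z := by
      refine (B.hasFDerivAt.clm_apply (hasFDerivAt_id z)).congr_fderiv ?_
      ext u
      simp [hsymm u z]
    refine HasFDerivAt.hasFDerivWithinAt ?_
    refine (((d1.sub_const (2 * w x)).add d2).sub d3).congr_fderiv ?_
    abel
  have hbound : ∀ z ∈ Metric.closedBall (0 : E) ‖y‖,
      ‖fderiv ℝ w (x + z) - fderiv ℝ w (x - z) - (B z + B z)‖ ≤ c * ‖y‖ := by
    intro z hz
    simp only [mem_closedBall_zero_iff, mem_ball_zero_iff] at hz hy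
    exact (hball z (by simpa using hz.trans_lt hy)).1.trans (by gcongr)
  have key := (convex_closedBall (0 : E) ‖y‖).norm_image_sub_le_of_norm_hasFDerivWithin_le
    hderiv hbound (x := 0) (y := y) (by simp) (by simp)
  have h0 : w (x + 0) - 2 * w x + w (x - 0) - B 0 0 = 0 := by simp; ring
  rw [h0, sub_zero, sub_zero] at key
  simpa [pow_two, mul_assoc] using key

/-- Change of variables under an invertible linear map, for an additive Haar measure. -/
lemma MeasureTheory.Measure.integral_comp_linearMap {E F : Type*} [NormedAddCommGroup E]
    [NormedSpace ℝ E] [MeasurableSpace E] [BorelSpace E] [FiniteDimensional ℝ E]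
    [NormedAddCommGroup F] [NormedSpace ℝ F] (μ : Measure E) [μ.IsAddHaarMeasure]
    {f : E →ₗ[ℝ] E} (hf : LinearMap.det f ≠ 0) (g : E → F) :
    ∫ z, g (f z) ∂μ = |(LinearMap.det f)⁻¹| • ∫ y, g y ∂μ := by
  have hemb : MeasurableEmbedding f :=
    (LinearMap.equivOfDetNeZero f hf).toContinuousLinearEquiv.toHomeomorph.measurableEmbedding
  rw [← hemb.integral_map, Measure.map_linearMap_addHaar_eq_smul_addHaar μ hf,
    integral_smul_measure, ENNReal.toReal_ofReal (abs_nonneg _)]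

lemma Matrix.det_toEuclideanLin {ι : Type*} [Fintype ι] [DecidableEq ι] (M : Matrix ι ι ℝ) :
    LinearMap.det (toEuclideanLin M) = M.det := by
  rw [toEuclideanLin_eq_toLin_orthonormal, LinearMap.det_toLin]

/-- The second-moment integrands of an integrable function supported in the unit ball are
integrable. -/
lemma integrable_mul_mul_of_support_subset_closedBall {ι : Type*} [Fintype ι]
    {φ : EuclideanSpace ℝ ι → ℝ} (hint : Integrable φ)
    (hsupp : Function.support φ ⊆ Metric.closedBall 0 1) (i j : ι) :
    Integrable fun z : EuclideanSpace ℝ ι => z i * z j * φ z := by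
  refine hint.norm.mono' ?_ (ae_of_all _ fun z => ?_)
  · exact (Continuous.aestronglyMeasurable (by fun_prop)).mul hint.aestronglyMeasurable
  · by_cases hz : φ z = 0
    · simp [hz]
    · have hz1 : ‖z‖ ≤ 1 := by simpa using hsupp hz
      have h1 : ‖z i‖ ≤ 1 := (PiLp.norm_apply_le z i).trans hz1
      have h2 : ‖z j‖ ≤ 1 := (PiLp.norm_apply_le z j).trans hz1
      rw [norm_mul, norm_mul]
      exact mul_le_of_le_one_left (norm_nonneg _) (mul_le_one₀ h1 (norm_nonneg _) h2)

section Radial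

variable {ι : Type*} [Fintype ι] [DecidableEq ι] {φ : EuclideanSpace ℝ ι → ℝ}

/-- The mixed second moments of a radial function vanish. -/
lemma integral_mul_radial_eq_zero (hφ : ∀ y z, ‖y‖ = ‖z‖ → φ y = φ z) {i j : ι} (hij : i ≠ j) :
    ∫ z : EuclideanSpace ℝ ι, z i * z j * φ z = 0 := by
  let e : EuclideanSpace ℝ ι ≃ₗᵢ[ℝ] EuclideanSpace ℝ ι :=
    LinearIsometryEquiv.piLpCongrRight 2
      fun k => if k = i then LinearIsometryEquiv.neg ℝ else .refl ℝ ℝ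
  have hi : ∀ z, e z i = -z i := fun z => by simp [e]
  have hj : ∀ z, e z j = z j := fun z => by simp [e, hij.symm]
  have h := MeasureTheory.integral_comp e fun z => z i * z j * φ z
  simp only [hi, hj, hφ _ _ (e.norm_map _), neg_mul, integral_neg] at h
  linarith

/-- The pure second moments of a radial function coincide. -/
lemma integral_mul_self_radial_eq (hφ : ∀ y z, ‖y‖ = ‖z‖ → φ y = φ z) (i j : ι) :
    ∫ z : EuclideanSpace ℝ ι, z i * z i * φ z = ∫ z : EuclideanSpace ℝ ι, z j * z j * φ z := by
  let e : EuclideanSpace ℝ ι ≃ₗᵢ[ℝ] EuclideanSpace ℝ ι :=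
    LinearIsometryEquiv.piLpCongrLeft 2 ℝ ℝ (Equiv.swap i j)
  have hi : ∀ z, e z i = z j := fun z => by
    simp [e, LinearIsometryEquiv.piLpCongrLeft_apply, Equiv.piCongrLeft']
  have h := MeasureTheory.integral_comp e fun z => z i * z i * φ z
  simpa only [hi, hφ _ _ (e.norm_map _)] using h.symm

/-- The second moment matrix of a radial function with total second moment `card ι` is the
identity. -/
lemma integral_mul_mul_radial (hφ : ∀ y z, ‖y‖ = ‖z‖ → φ y = φ z) (hint : Integrable φ)
    (hsupp : Function.support φ ⊆ Metric.closedBall 0 1)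
    (hnorm : ∫ z, ‖z‖ ^ 2 * φ z = Fintype.card ι) (i j : ι) :
    ∫ z : EuclideanSpace ℝ ι, z i * z j * φ z = (1 : Matrix ι ι ℝ) i j := by
  rcases eq_or_ne i j with rfl | hij
  · have hsum : ∫ z, ‖z‖ ^ 2 * φ z
        = ∑ k, ∫ z : EuclideanSpace ℝ ι, z k * z k * φ z := by
      rw [← integral_finsetSum _ fun k _ =>
        integrable_mul_mul_of_support_subset_closedBall hint hsupp k k]
      congr with z
      rw [EuclideanSpace.real_norm_sq_eq, Finset.sum_mul]
      simp only [pow_two]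
    simp only [integral_mul_self_radial_eq hφ _ i, Finset.sum_const, Finset.card_univ,
      nsmul_eq_mul, hnorm] at hsum
    have : (Fintype.card ι : ℝ) ≠ 0 := by
      have : Nonempty ι := ⟨i⟩
      exact_mod_cast Fintype.card_ne_zero
    rw [Matrix.one_apply_eq]
    exact (mul_left_cancel₀ this (by rw [mul_one]; exact hsum)).symm
  · rw [integral_mul_radial_eq_zero hφ hij, Matrix.one_apply_ne hij]

/-- Averaging a quadratic form, precomposed with `M`, against an isotropic function. -/
lemma integral_bilin_toEuclideanLin_mul (hint : Integrable φ)
    (hsupp : Function.support φ ⊆ Metric.closedBall 0 1)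
    (hmom : ∀ i j, ∫ z : EuclideanSpace ℝ ι, z i * z j * φ z = (1 : Matrix ι ι ℝ) i j)
    (M : Matrix ι ι ℝ) (B : EuclideanSpace ℝ ι →L[ℝ] EuclideanSpace ℝ ι →L[ℝ] ℝ) :
    ∫ z, B (toEuclideanLin M z) (toEuclideanLin M z) * φ z
      = ∑ i, ∑ j, (M * Mᵀ) i j *
          B (EuclideanSpace.single i 1) (EuclideanSpace.single j 1) := by
  have hB : ∀ u v, B u v = ∑ i, ∑ j,
      u i * v j * B (EuclideanSpace.single i 1) (EuclideanSpace.single j 1) := fun u v => by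
    conv_lhs => rw [← (EuclideanSpace.basisFun ι ℝ).sum_repr u,
      ← (EuclideanSpace.basisFun ι ℝ).sum_repr v]
    simp only [map_sum, map_smul, _root_.sum_apply, _root_.smul_apply, smul_eq_mul,
      EuclideanSpace.basisFun_repr, EuclideanSpace.basisFun_apply, Finset.mul_sum, mul_assoc]
    rw [Finset.sum_comm]
    exact Finset.sum_congr rfl fun i _ => Finset.sum_congr rfl fun j _ => mul_left_comm _ _ _
  have hpt : ∀ z, B (toEuclideanLin M z) (toEuclideanLin M z) * φ z
      = ∑ i, ∑ j, ∑ k, ∑ l, M i k * M j l *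
          B (EuclideanSpace.single i 1) (EuclideanSpace.single j 1) * (z k * z l * φ z) := by
    intro z
    rw [hB, Finset.sum_mul]
    refine Finset.sum_congr rfl fun i _ => ?_
    rw [Finset.sum_mul]
    refine Finset.sum_congr rfl fun j _ => ?_
    simp only [ofLp_toLpLin, toLin'_apply, mulVec, dotProduct]
    rw [Finset.sum_mul_sum, Finset.sum_mul, Finset.sum_mul]
    refine Finset.sum_congr rfl fun k _ => ?_
    rw [Finset.sum_mul, Finset.sum_mul]
    exact Finset.sum_congr rfl fun l _ => by ring
  have hI : ∀ i j k l, Integrable fun z : EuclideanSpace ℝ ι => M i k * M j l *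
      B (EuclideanSpace.single i 1) (EuclideanSpace.single j 1) * (z k * z l * φ z) :=
    fun i j k l => (integrable_mul_mul_of_support_subset_closedBall hint hsupp k l).const_mul _
  simp_rw [hpt]
  rw [integral_finsetSum _ fun i _ => integrable_finsetSum _ fun j _ =>
    integrable_finsetSum _ fun k _ => integrable_finsetSum _ fun l _ => hI i j k l]
  refine Finset.sum_congr rfl fun i _ => ?_
  rw [integral_finsetSum _ fun j _ =>
    integrable_finsetSum _ fun k _ => integrable_finsetSum _ fun l _ => hI i j k l]
  refine Finset.sum_congr rfl fun j _ => ?_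
  rw [integral_finsetSum _ fun k _ => integrable_finsetSum _ fun l _ => hI i j k l]
  rw [Matrix.mul_apply, Finset.sum_mul]
  refine Finset.sum_congr rfl fun k _ => ?_
  rw [integral_finsetSum _ fun l _ => hI i j k l]
  simp_rw [integral_const_mul, hmom]
  simp [Matrix.one_apply]

end Radial

/-- The integral operator after the substitution `y = ε M z`. -/
lemma intOp_eq_integral {d : ℕ} (φ : EuclideanSpace ℝ (Fin d) → ℝ) {ε : ℝ} (hε : 0 < ε)
    {M : Matrix (Fin d) (Fin d) ℝ} (hM : 0 < M.det) (w : EuclideanSpace ℝ (Fin d) → ℝ)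
    (x : EuclideanSpace ℝ (Fin d)) :
    intOp φ ε M w x =
      ∫ z, (ε ^ 2)⁻¹ * centeredSecondDiff w x (ε • toEuclideanLin M z) * φ z := by
  have hdet : LinearMap.det (ε • toEuclideanLin M) = ε ^ d * M.det := by
    rw [LinearMap.det_smul, Matrix.det_toEuclideanLin, finrank_euclideanSpace_fin]
  have hpos : 0 < ε ^ d * M.det := by positivity
  have hcv := Measure.integral_comp_linearMap (volume : Measure (EuclideanSpace ℝ (Fin d)))
    (hdet.trans_ne hpos.ne')
    fun y => centeredSecondDiff w x y * φ (ε⁻¹ • toEuclideanLin M⁻¹ y)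
  have hinv : ∀ z, ε⁻¹ • toEuclideanLin M⁻¹ ((ε • toEuclideanLin M) z) = z := fun z => by
    rw [LinearMap.smul_apply, map_smul, inv_smul_smul₀ hε.ne']
    simp [toLpLin_apply, Matrix.nonsing_inv_mul _ hM.ne'.isUnit]
  simp only [hinv, hdet, abs_of_pos (inv_pos.2 hpos), smul_eq_mul] at hcv
  simp only [mul_assoc, integral_const_mul]
  simp only [LinearMap.smul_apply] at hcv
  rw [hcv, intOp, ← mul_assoc, ← mul_inv, pow_add, mul_comm (ε ^ d), mul_assoc]

/-- Consistency of the integral operator: if `w` is `C²` near `x` with Hessian matrix `H`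
at `x`, then `I_ε^M w(x) → M² : D²w(x) = Σᵢⱼ (M²)ᵢⱼ Hᵢⱼ` as `ε → 0⁺`. -/
theorem intOp_consistency (d : ℕ) (hd : 1 ≤ d)
    (φ : EuclideanSpace ℝ (Fin d) → ℝ)
    (hφ0 : ∀ y, 0 ≤ φ y)
    (hφint : Integrable φ)
    (hφrad : ∀ y₁ y₂ : EuclideanSpace ℝ (Fin d), ‖y₁‖ = ‖y₂‖ → φ y₁ = φ y₂)
    (hφsupp : Function.support φ ⊆ Metric.closedBall 0 1)
    (hφnorm : (∫ y : EuclideanSpace ℝ (Fin d), ‖y‖ ^ 2 * φ y) = d)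
    (M : Matrix (Fin d) (Fin d) ℝ) (hMsym : M.IsSymm) (hMpos : M.PosDef)
    (w : EuclideanSpace ℝ (Fin d) → ℝ)
    (hwmeas : Measurable w) (hwbd : ∃ B : ℝ, ∀ x, |w x| ≤ B)
    (x : EuclideanSpace ℝ (Fin d))
    (U : Set (EuclideanSpace ℝ (Fin d))) (hU : U ∈ nhds x)
    (hw2 : ContDiffOn ℝ 2 w U)
    (H : Matrix (Fin d) (Fin d) ℝ)
    (hH : ∀ i j, H i j =
      iteratedFDeriv ℝ 2 w x ![EuclideanSpace.single i (1 : ℝ), EuclideanSpace.single j (1 : ℝ)]) :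
    Filter.Tendsto (fun ε : ℝ => intOp φ ε M w x)
      (nhdsWithin 0 (Set.Ioi 0))
      (nhds (∑ i, ∑ j, (M * M) i j * H i j)) := by
  obtain ⟨B, hB⟩ : ∃ B, B = fderiv ℝ (fderiv ℝ w) x := ⟨_, rfl⟩
  have hlittle := (hw2.contDiffAt hU).centered_second_difference_isLittleO
  rw [← hB] at hlittle
  have hlim : (∑ i, ∑ j, (M * M) i j * H i j)
      = ∫ z, B (toEuclideanLin M z) (toEuclideanLin M z) * φ z := by
    rw [integral_bilin_toEuclideanLin_mul hφint hφsupp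
      (integral_mul_mul_radial hφrad hφint hφsupp (by simpa using hφnorm)), hMsym.eq]
    simp [hH, iteratedFDeriv_two_apply, hB]
  set T : EuclideanSpace ℝ (Fin d) →L[ℝ] EuclideanSpace ℝ (Fin d) :=
    (toEuclideanLin M).toContinuousLinearMap with hT
  have hTM : ∀ z, toEuclideanLin M z = T z := fun z => rfl
  have hsmall : ∀ c > 0, ∀ᶠ ε in 𝓝[>] (0 : ℝ),
      ∀ z ∈ Metric.closedBall (0 : EuclideanSpace ℝ (Fin d)) 1,
      ‖(ε ^ 2)⁻¹ * centeredSecondDiff w x (ε • T z) - B (T z) (T z)‖ ≤ c * ‖T‖ ^ 2 := by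
    intro c hc
    obtain ⟨r, hr, hball⟩ := Metric.eventually_nhds_iff_ball.1 (hlittle.def hc)
    have ht : Tendsto (fun ε : ℝ => ε * ‖T‖) (𝓝[>] 0) (𝓝 0) := by
      have : Tendsto (fun ε : ℝ => ε * ‖T‖) (𝓝 0) (𝓝 (0 * ‖T‖)) := tendsto_id.mul_const _
      rw [zero_mul] at this
      exact this.mono_left nhdsWithin_le_nhds
    filter_upwards [ht.eventually_lt_const hr, self_mem_nhdsWithin] with ε hεr hε z hz
    have hε : 0 < ε := hε
    have hTz : ‖T z‖ ≤ ‖T‖ := T.unit_le_opNorm z (by simpa using hz)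
    have hnorm : ‖ε • T z‖ = ε * ‖T z‖ := by rw [norm_smul, Real.norm_of_nonneg hε.le]
    have hmem : ε • T z ∈ Metric.ball (0 : EuclideanSpace ℝ (Fin d)) r := by
      rw [mem_ball_zero_iff, hnorm]
      exact lt_of_le_of_lt (by gcongr) hεr
    have h := hball _ hmem
    have heq : (ε ^ 2)⁻¹ * centeredSecondDiff w x (ε • T z) - B (T z) (T z)
        = (ε ^ 2)⁻¹ * (w (x + ε • T z) - 2 * w x + w (x - ε • T z) - B (ε • T z) (ε • T z)) := by
      simp only [centeredSecondDiff, map_smul, _root_.smul_apply, smul_eq_mul]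
      field_simp
    rw [heq, norm_mul, Real.norm_of_nonneg (by positivity : (0 : ℝ) ≤ (ε ^ 2)⁻¹)]
    calc (ε ^ 2)⁻¹ * _ ≤ (ε ^ 2)⁻¹ * (c * ‖‖ε • T z‖ ^ 2‖) := by gcongr
      _ = c * ‖T z‖ ^ 2 := by
        rw [Real.norm_of_nonneg (by positivity), hnorm]
        field_simp
      _ ≤ c * ‖T‖ ^ 2 := by gcongr
  rw [hlim]
  refine Tendsto.congr' (f₁ := fun ε : ℝ =>
    ∫ z, (ε ^ 2)⁻¹ * centeredSecondDiff w x (ε • T z) * φ z) ?_ ?_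
  · filter_upwards [self_mem_nhdsWithin] with ε hε
    exact (intOp_eq_integral φ hε hMpos.det_pos w x).symm
  simp only [hTM]
  refine tendsto_integral_filter_of_dominated_convergence
    (fun z => (1 * ‖T‖ ^ 2 + ‖B‖ * ‖T‖ * ‖T‖) * ‖φ z‖) ?_ ?_ (hφint.norm.const_mul _) ?_
  · refine Eventually.of_forall fun ε => AEStronglyMeasurable.mul ?_ hφint.aestronglyMeasurable
    unfold centeredSecondDiff
    have : Measurable fun z => T z := T.continuous.measurable
    exact Measurable.aestronglyMeasurable (by fun_prop)
  · filter_upwards [hsmall 1 one_pos] with ε hε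
    refine ae_of_all _ fun z => ?_
    by_cases hz : φ z = 0
    · simp [hz]
    have hz1 := hφsupp hz
    have hTz : ‖T z‖ ≤ ‖T‖ := T.unit_le_opNorm z (by simpa using hz1)
    rw [norm_mul]
    gcongr
    refine (norm_le_norm_sub_add _ (B (T z) (T z))).trans (add_le_add (hε z hz1) ?_)
    exact (B.le_opNorm₂ _ _).trans (by gcongr)
  · refine ae_of_all _ fun z => ?_
    by_cases hz : φ z = 0
    · simp [hz]
    refine Tendsto.mul_const _ ?_
    rw [Metric.tendsto_nhds]
    intro δ hδ
    filter_upwards [hsmall (δ / (2 * (‖T‖ ^ 2 + 1))) (by positivity)] with ε hε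
    rw [dist_eq_norm]
    refine (hε z (hφsupp hz)).trans_lt ?_
    rw [div_mul_eq_mul_div, div_lt_iff₀ (by positivity)]
    nlinarith [sq_nonneg ‖T‖]
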